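/- For all real a > 0 and p > 0: ∫₀^{a} (x − p)·max(√x, √p)/√(x·(a − x)) dx = (1/3)·(4a − 7p)·√(a − p) + (a − 2p)·√p · arcsin √(p/a) if p < a, and = (π/2)·(a − 2p)·√p if p ≥ a. -/

import Mathlib

open MeasureTheory Real

lemma hd1 (a p x : ℝ) (h0 : 0 < x) (h1 : x < a) :
    HasDerivAt (fun x => √p * (√(x*(a-x)) - (a-2*p) * arcsin (√(x/a))))
      (√p * ((p - x) / √(x*(a-x)))) x := by
  have ha : 0 < a := h0.trans h1
  have hax : 0 < a - x := by linarith
  have hq : 0 < x / a := by positivity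
  have hq1 : x / a < 1 := (div_lt_one ha).2 h1
  have e1 : HasDerivAt (fun x => x*(a-x)) (1*(a-x) + x*(0-1)) x :=
    (hasDerivAt_id x).mul ((hasDerivAt_const x a).sub (hasDerivAt_id x))
  have e2 := e1.sqrt (by positivity)
  have e3 : HasDerivAt (fun x => √(x/a)) _ x := ((hasDerivAt_id x).div_const a).sqrt hq.ne'
  have hs1 : √(x/a) < 1 := by rw [sqrt_lt' one_pos]; simpa using hq1
  have hs0 : 0 < √(x/a) := sqrt_pos.2 hq
  have e4 := (hasDerivAt_arcsin (x := √(x/a)) (by linarith) hs1.ne).comp x e3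
  have e5 := (e2.sub (e4.const_mul (a-2*p))).const_mul (√p)
  refine e5.congr_deriv ?_
  congr 1
  have k1 : 1 - √(x/a)^2 = (a-x)/a := by rw [sq_sqrt hq.le]; field_simp
  simp only [id]
  rw [k1, sqrt_div hax.le, sqrt_div h0.le, sqrt_mul h0.le]
  have r1 : 0 < √x := sqrt_pos.2 h0
  have r2 : 0 < √(a-x) := sqrt_pos.2 hax
  have r3 : 0 < √a := sqrt_pos.2 ha
  have r4 : √a^2 = a := sq_sqrt ha.le
  field_simp
  rw [r4]
  ring

lemma hd2 (a p x : ℝ) (h1 : x < a) :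
    HasDerivAt (fun x => (2/3) * ((a-x) * √(a-x)) - 2*(a-p)*√(a-x))
      ((x - p) / √(a-x)) x := by
  have hax : 0 < a - x := by linarith
  have e1 : HasDerivAt (fun x => a-x) (0-1) x :=
    (hasDerivAt_const x a).sub (hasDerivAt_id x)
  have e2 := e1.sqrt hax.ne'
  have e3 := ((e1.mul e2).const_mul (2/3)).sub (e2.const_mul (2*(a-p)))
  refine e3.congr_deriv ?_
  have r2 : 0 < √(a-x) := sqrt_pos.2 hax
  have r4 : √(a-x)^2 = a-x := sq_sqrt hax.le
  field_simp
  rw [r4]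
  ring

lemma part1 (a p c : ℝ) (hc0 : 0 < c) (hca : c ≤ a) (hcp : c ≤ p) :
    IntervalIntegrable (fun x => (x - p) * max (√x) (√p) / √(x*(a - x))) volume 0 c ∧
    ∫ x in (0:ℝ)..c, (x - p) * max (√x) (√p) / √(x*(a - x)) =
      - (√p * (√(c*(a-c)) - (a-2*p) * arcsin (√(c/a)))) := by
  have hcont : ContinuousOn (fun x => √p * (√(x*(a-x)) - (a-2*p) * arcsin (√(x/a))))
      (Set.Icc 0 c) := by
    apply Continuous.continuousOn
    have := continuous_arcsin
    fun_prop
  have hder : ∀ x ∈ Set.Ioo 0 c,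
      HasDerivAt (fun x => √p * (√(x*(a-x)) - (a-2*p) * arcsin (√(x/a))))
      (√p * ((p - x) / √(x*(a-x)))) x :=
    fun x hx => hd1 a p x hx.1 (hx.2.trans_le hca)
  have hint : IntervalIntegrable (fun x => √p * ((p - x) / √(x*(a-x)))) volume 0 c := by
    apply intervalIntegral.intervalIntegrable_deriv_of_nonneg
      (g := fun x => √p * (√(x*(a-x)) - (a-2*p) * arcsin (√(x/a))))
    · rwa [Set.uIcc_of_le hc0.le]
    · rwa [min_eq_left hc0.le, max_eq_right hc0.le]
    · rw [min_eq_left hc0.le, max_eq_right hc0.le]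
      intro x hx
      have : 0 ≤ p - x := by linarith [hx.2]
      positivity
  have hI := intervalIntegral.integral_eq_sub_of_hasDerivAt_of_le hc0.le hcont hder hint
  have heq : Set.EqOn (fun x => -(√p * ((p - x) / √(x*(a-x)))))
      (fun x => (x - p) * max (√x) (√p) / √(x*(a - x))) (Set.uIcc 0 c) := by
    intro x hx
    rw [Set.uIcc_of_le hc0.le] at hx
    have : √x ≤ √p := sqrt_le_sqrt (hx.2.trans hcp)
    simp only [max_eq_right this]
    ring
  refine ⟨hint.neg.congr (fun x hx => heq (Set.uIoc_subset_uIcc hx)), ?_⟩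
  rw [← intervalIntegral.integral_congr heq, intervalIntegral.integral_neg, hI]
  simp

lemma part2 (a p : ℝ) (hp : 0 < p) (hpa : p < a) :
    IntervalIntegrable (fun x => (x - p) * max (√x) (√p) / √(x*(a - x))) volume p a ∧
    ∫ x in p..a, (x - p) * max (√x) (√p) / √(x*(a - x)) =
      (4/3) * ((a-p) * √(a-p)) := by
  have hcont : ContinuousOn (fun x => (2/3) * ((a-x) * √(a-x)) - 2*(a-p)*√(a-x))
      (Set.Icc p a) := by
    apply Continuous.continuousOn
    fun_prop
  have hder : ∀ x ∈ Set.Ioo p a,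
      HasDerivAt (fun x => (2/3) * ((a-x) * √(a-x)) - 2*(a-p)*√(a-x))
      ((x - p) / √(a-x)) x :=
    fun x hx => hd2 a p x hx.2
  have hint : IntervalIntegrable (fun x => (x - p) / √(a-x)) volume p a := by
    apply intervalIntegral.intervalIntegrable_deriv_of_nonneg
      (g := fun x => (2/3) * ((a-x) * √(a-x)) - 2*(a-p)*√(a-x))
    · rwa [Set.uIcc_of_le hpa.le]
    · rwa [min_eq_left hpa.le, max_eq_right hpa.le]
    · rw [min_eq_left hpa.le, max_eq_right hpa.le]
      intro x hx
      have : 0 ≤ x - p := by linarith [hx.1]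
      positivity
  have hI := intervalIntegral.integral_eq_sub_of_hasDerivAt_of_le hpa.le hcont hder hint
  have heq : Set.EqOn (fun x => (x - p) / √(a-x))
      (fun x => (x - p) * max (√x) (√p) / √(x*(a - x))) (Set.uIcc p a) := by
    intro x hx
    rw [Set.uIcc_of_le hpa.le] at hx
    have : √p ≤ √x := sqrt_le_sqrt hx.1
    have h0 : 0 < x := hp.trans_le hx.1
    have r1 : 0 < √x := sqrt_pos.2 h0
    simp only [max_eq_left this]
    rw [sqrt_mul h0.le, mul_comm (√x), mul_div_mul_right _ _ r1.ne']
  refine ⟨hint.congr (fun x hx => heq (Set.uIoc_subset_uIcc hx)), ?_⟩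
  rw [← intervalIntegral.integral_congr heq, hI]
  simp
  ring


/-- The first moment of the energy transfer rate of the Markov jump process of
energy exchanges (`a` is the ball energy, `p` the piston energy). -/
theorem stmt_13 (a p : ℝ) (ha : 0 < a) (hp : 0 < p) :
    (p < a →
      ∫ x in (0:ℝ)..a,
          (x - p) * max (Real.sqrt x) (Real.sqrt p) / Real.sqrt (x*(a - x)) =
        (1/3) * (4*a - 7*p) * Real.sqrt (a - p)
          + (a - 2*p) * Real.sqrt p * Real.arcsin (Real.sqrt (p/a))) ∧
    (a ≤ p →
      ∫ x in (0:ℝ)..a,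
          (x - p) * max (Real.sqrt x) (Real.sqrt p) / Real.sqrt (x*(a - x)) =
        (Real.pi/2) * (a - 2*p) * Real.sqrt p) := by

  constructor
  · intro h
    obtain ⟨i1, v1⟩ := part1 a p p hp h.le le_rfl
    obtain ⟨i2, v2⟩ := part2 a p hp h
    rw [← intervalIntegral.integral_add_adjacent_intervals i1 i2, v1, v2, sqrt_mul hp.le]
    have := mul_self_sqrt hp.le
    linear_combination (-√(a-p)) * this
  · intro h
    rw [(part1 a p a ha le_rfl h).2, div_self ha.ne']
    simp
    ring
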